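/- arXiv:1911.01895 — 4 statements merged into one kernel-verified Lean document; each statement's English description precedes it below -/
import Mathlib

section
/- Let C be a small category and let κ be an infinite regular cardinal such that |C| < κ and κ is sharply larger than |C|. Then a presheaf X : Cᵒᵖ ⥤ Type is κ-compact (i.e. κ-presentable) in the presheaf category if and only if X is κ-small. -/
open CategoryTheory CategoryTheory.Limits Cardinal Opposite

/-- The cardinality of a small category: the sum, over all pairs of objects,
of the cardinalities of the hom-sets. -/
noncomputable def catCard (C : Type) [SmallCategory C] : Cardinal :=
  Cardinal.mk (Σ (c : C) (c' : C), c ⟶ c')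

/-- `κ` is sharply larger than `μ` (written `μ ≪ κ`): for all `κ₀ < κ` and `μ₀ < μ`,
`κ₀ ^ μ₀ < κ`. -/
def SharplyLarger (μ κ : Cardinal) : Prop :=
  ∀ κ₀ < κ, ∀ μ₀ < μ, κ₀ ^ μ₀ < κ

/-- A presheaf `X : Cᵒᵖ ⥤ Type` is `κ`-small if the sum over all objects `c` of the
cardinality of `X(c)` is less than `κ`. -/
def PshSmall {C : Type} [SmallCategory C] (κ : Cardinal) (X : Cᵒᵖ ⥤ Type) : Prop :=
  Cardinal.mk (Σ c : C, X.obj (op c)) < κ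

/-- A small category `J` is `κ`-filtered if every diagram indexed by a category with
fewer than `κ` morphisms admits a cocone. -/
def IsKappaFiltered (κ : Cardinal) (J : Type) [SmallCategory J] : Prop :=
  ∀ (K : Type) [SmallCategory K], catCard K < κ → ∀ F : K ⥤ J, Nonempty (Cocone F)

/-- An object `X` of a category is `κ`-compact (`κ`-presentable) if `Hom(X, −)`
preserves colimits of all `κ`-filtered shapes. -/
def IsKappaCompact {D : Type u} [Category.{0} D] (κ : Cardinal) (X : D) : Prop :=
  ∀ (J : Type) [SmallCategory J], IsKappaFiltered κ J →
    Nonempty (PreservesColimitsOfShape J (coyoneda.obj (op X)))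

section

variable {C : Type} [SmallCategory C] {κ : Cardinal}

lemma catCard_eq_mk_arrow (K : Type) [SmallCategory K] : catCard K = Cardinal.mk (Arrow K) :=
  Cardinal.mk_congr
    { toFun p := Arrow.mk p.2.2
      invFun f := ⟨f.left, f.right, f.hom⟩
      left_inv _ := rfl
      right_inv _ := rfl }

lemma isKappaFiltered_iff_isCardinalFiltered [Fact κ.IsRegular] (J : Type) [SmallCategory J] :
    IsKappaFiltered κ J ↔ IsCardinalFiltered J κ := by
  refine ⟨fun h ↦ ⟨fun {A} _ F hA ↦ h A ?_ F⟩, fun h K _ hK F ↦ h.nonempty_cocone F ?_⟩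
  · rwa [catCard_eq_mk_arrow, ← hasCardinalLT_iff_cardinal_mk_lt]
  · rwa [hasCardinalLT_iff_cardinal_mk_lt, ← catCard_eq_mk_arrow]

lemma isKappaCompact_iff_isCardinalPresentable [Fact κ.IsRegular]
    {D : Type*} [Category.{0} D] (X : D) :
    IsKappaCompact κ X ↔ IsCardinalPresentable X κ := by
  refine ⟨fun h ↦ ⟨fun J _ hJ ↦ ?_⟩, fun h J _ hJ ↦ ⟨?_⟩⟩
  · exact (h J ((isKappaFiltered_iff_isCardinalFiltered J).2 hJ)).some
  · have := (isKappaFiltered_iff_isCardinalFiltered J).1 hJ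
    exact preservesColimitsOfShape_of_isCardinalPresentable X κ J

lemma hasCardinalLT_sigma_hom (h : catCard C < κ) (c : C) :
    HasCardinalLT (Σ c' : C, c' ⟶ c) κ := by
  refine HasCardinalLT.of_injective ((hasCardinalLT_iff_cardinal_mk_lt _ _).2 h) (fun p ↦ ⟨p.1, c, p.2⟩) ?_
  rintro ⟨a, f⟩ ⟨b, g⟩ h
  aesop

lemma PshSmall.hasCardinalLT_arrow_elements [Fact κ.IsRegular] (hC : catCard C < κ)
    {X : Cᵒᵖ ⥤ Type} (hX : PshSmall κ X) : HasCardinalLT (Arrow X.Elementsᵒᵖ) κ := by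
  refine HasCardinalLT.of_surjective
    (X := Σ p : (Σ c : C, X.obj (op c)), Σ c' : C, c' ⟶ p.1)
    (hasCardinalLT_sigma _ _ ((hasCardinalLT_iff_cardinal_mk_lt _ _).2 hX)
      fun p ↦ hasCardinalLT_sigma_hom hC p.1)
    (fun p ↦ Arrow.mk (CategoryOfElements.homMk (X.elementsMk (op p.1.1) p.1.2)
      (X.elementsMk (op p.2.1) (X.map p.2.2.op p.1.2)) p.2.2.op rfl).op) ?_
  rintro ⟨⟨⟨c', y⟩⟩, ⟨⟨c, x⟩⟩, f⟩
  obtain ⟨g, rfl, rfl⟩ : ∃ (g : c ⟶ c') (hg : X.map g x = y),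
      f = (CategoryOfElements.homMk (X.elementsMk c x) (X.elementsMk c' y) g hg).op :=
    ⟨f.unop.1, f.unop.2, rfl⟩
  exact ⟨⟨⟨c.unop, x⟩, c'.unop, g.unop⟩, rfl⟩

lemma PshSmall.isCardinalPresentable [Fact κ.IsRegular] (hC : catCard C < κ)
    {X : Cᵒᵖ ⥤ Type} (hX : PshSmall κ X) : IsCardinalPresentable X κ := by
  have (k : X.Elementsᵒᵖ) :
      IsCardinalPresentable ((Presheaf.functorToRepresentables.{0} X).obj k) κ := by
    dsimp [Presheaf.functorToRepresentables]
    infer_instance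
  exact isCardinalPresentable_of_isColimit' _ (Presheaf.colimitOfRepresentable.{0} X) κ
    (hX.hasCardinalLT_arrow_elements hC)

lemma pshSmall_ofSection (hC : catCard C < κ) {X : Cᵒᵖ ⥤ Type} {c : C} (x : X.obj (op c)) :
    PshSmall κ (Subfunctor.ofSection x).toFunctor := by
  rw [PshSmall, ← hasCardinalLT_iff_cardinal_mk_lt]
  refine HasCardinalLT.of_surjective (hasCardinalLT_sigma_hom hC c)
    (fun p ↦ ⟨p.1, X.map p.2.op x, p.2.op, rfl⟩) ?_
  rintro ⟨c', _, f, rfl⟩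
  exact ⟨⟨c', f.unop⟩, rfl⟩

lemma pshSmall_iSup [Fact κ.IsRegular] {X : Cᵒᵖ ⥤ Type} {ι : Type} (hι : HasCardinalLT ι κ)
    (A : ι → Subfunctor X) (hA : ∀ i, PshSmall κ (A i).toFunctor) :
    PshSmall κ (⨆ i, A i).toFunctor := by
  rw [PshSmall, ← hasCardinalLT_iff_cardinal_mk_lt]
  refine HasCardinalLT.of_surjective
    (hasCardinalLT_sigma (fun i ↦ Σ c : C, (A i).toFunctor.obj (op c)) κ hι
      fun i ↦ (hasCardinalLT_iff_cardinal_mk_lt _ _).2 (hA i))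
    (fun p ↦ ⟨p.2.1, p.2.2.1, le_iSup A p.1 _ p.2.2.2⟩) ?_
  rintro ⟨c, x, hx⟩
  obtain ⟨i, hi⟩ : ∃ i, x ∈ (A i).obj (op c) := by simpa using hx
  exact ⟨⟨i, c, x, hi⟩, rfl⟩

/-- The preordered type of `κ`-small subpresheaves of `X`. -/
abbrev SmallSubfunctor (κ : Cardinal) (X : Cᵒᵖ ⥤ Type) :=
  { A : Subfunctor X // PshSmall κ A.toFunctor }

namespace SmallSubfunctor

variable (X : Cᵒᵖ ⥤ Type)

instance [Fact κ.IsRegular] : IsCardinalFiltered (SmallSubfunctor κ X) κ :=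
  isCardinalFiltered_preorder _ _ fun _ A hι ↦
    ⟨⟨⨆ i, (A i).1, pshSmall_iSup ((hasCardinalLT_iff_cardinal_mk_lt _ _).2 hι) _
      fun i ↦ (A i).2⟩, le_iSup (fun i ↦ (A i).1)⟩

/-- The diagram of `κ`-small subpresheaves of `X`. -/
@[simps]
def functor (κ : Cardinal) : SmallSubfunctor κ X ⥤ Cᵒᵖ ⥤ Type where
  obj A := A.1.toFunctor
  map f := Subfunctor.homOfLe (leOfHom f)

/-- The cocone with point `X` over the diagram of `κ`-small subpresheaves of `X`. -/
@[simps]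
def cocone (κ : Cardinal) : Cocone (functor X κ) where
  pt := X
  ι := { app A := A.1.ι }

/-- A presheaf is the colimit of its `κ`-small subpresheaves. -/
noncomputable def isColimitCocone [Fact κ.IsRegular] (hC : catCard C < κ) :
    IsColimit (cocone X κ) :=
  evaluationJointlyReflectsColimits _ fun c ↦ by
    have := isFiltered_of_isCardinalFiltered (SmallSubfunctor κ X) κ
    refine Types.FilteredColimit.isColimitOf' _ _ (fun x ↦ ?_) ?_
    · exact ⟨⟨Subfunctor.ofSection x, pshSmall_ofSection hC x⟩,
        ⟨x, Subfunctor.mem_ofSection_obj x⟩, rfl⟩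
    · rintro A ⟨x, hx⟩ ⟨y, hy⟩ h
      obtain rfl : x = y := h
      exact ⟨A, 𝟙 _, rfl⟩

end SmallSubfunctor

lemma pshSmall_of_isCardinalPresentable [Fact κ.IsRegular] (hC : catCard C < κ)
    (X : Cᵒᵖ ⥤ Type) [IsCardinalPresentable X κ] : PshSmall κ X := by
  obtain ⟨⟨A, hA⟩, f, hf⟩ := IsCardinalPresentable.exists_hom_of_isColimit κ
    (SmallSubfunctor.isColimitCocone X hC) (𝟙 X)
  rw [PshSmall, ← hasCardinalLT_iff_cardinal_mk_lt] at hA ⊢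
  refine HasCardinalLT.of_surjective hA (fun p ↦ ⟨p.1, p.2.1⟩) ?_
  rintro ⟨c, x⟩
  exact ⟨⟨c, f.app _ x⟩, Sigma.ext rfl (heq_of_eq
    (ConcreteCategory.congr_hom (NatTrans.congr_app hf (op c)) x :))⟩

end

/-- Lemma 3.1(a) of the paper (set-valued presheaf form): for `κ` an infinite regular
cardinal with `|C| < κ` and `|C| ≪ κ`, a presheaf is `κ`-compact iff it is `κ`-small. -/
theorem compact_iff_small (C : Type) [SmallCategory C] (κ : Cardinal)
    (hreg : κ.IsRegular) (hinf : ℵ₀ ≤ κ) (hlt : catCard C < κ)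
    (hsharp : SharplyLarger (catCard C) κ) (X : Cᵒᵖ ⥤ Type) :
    IsKappaCompact κ X ↔ PshSmall κ X := by
  have : Fact κ.IsRegular := ⟨hreg⟩
  rw [isKappaCompact_iff_isCardinalPresentable]
  exact ⟨fun _ ↦ pshSmall_of_isCardinalPresentable hlt X, fun h ↦ h.isCardinalPresentable hlt⟩
end

section
/- Let C be a small category and let κ be an infinite regular cardinal such that |C| < κ and κ is sharply larger than |C|. Then a morphism f : X ⟶ Y of presheaves Cᵒᵖ ⥤ Type is relative κ-compact if and only if f is κ-small. -/
open CategoryTheory CategoryTheory.Limits Cardinal Opposite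

/-- A morphism `f : X ⟶ Y` of presheaves is `κ`-small if every pullback of it along a map
with `κ`-small domain has `κ`-small domain. -/
def MapSmall {C : Type} [SmallCategory C] (κ : Cardinal) {X Y : Cᵒᵖ ⥤ Type} (f : X ⟶ Y) :
    Prop :=
  ∀ (Z : Cᵒᵖ ⥤ Type) (g : Z ⟶ Y), PshSmall κ Z → PshSmall κ (pullback g f)

/-- A morphism `f : X ⟶ Y` is relative `κ`-compact if every pullback of it along a map with
`κ`-compact domain has `κ`-compact domain. -/
def RelKappaCompact {D : Type u} [Category.{0} D] [HasPullbacks D] (κ : Cardinal)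
    {X Y : D} (f : X ⟶ Y) : Prop :=
  ∀ (Z : D) (g : Z ⟶ Y), IsKappaCompact κ Z → IsKappaCompact κ (pullback g f)

namespace PresheafCardinality

lemma hasCardinalLT_arrow_iff {K : Type} [SmallCategory K] (κ : Cardinal.{0}) :
    HasCardinalLT (Arrow K) κ ↔ catCard K < κ := by
  rw [hasCardinalLT_iff_of_equiv (Arrow.equivSigma K), hasCardinalLT_iff_cardinal_mk_lt, catCard]

lemma isKappaFiltered_iff (J : Type) [SmallCategory J] (κ : Cardinal.{0}) [Fact κ.IsRegular] :
    IsKappaFiltered κ J ↔ IsCardinalFiltered J κ :=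
  ⟨fun h ↦ ⟨fun F hA ↦ h _ ((hasCardinalLT_arrow_iff κ).1 hA) F⟩,
    fun _ _ _ hK F ↦ ⟨IsCardinalFiltered.cocone F ((hasCardinalLT_arrow_iff κ).2 hK)⟩⟩

lemma isKappaCompact_iff {D : Type*} [Category.{0} D] (X : D) (κ : Cardinal.{0})
    [Fact κ.IsRegular] : IsKappaCompact κ X ↔ IsCardinalPresentable X κ :=
  ⟨fun h ↦ ⟨fun J _ hJ ↦ (h J ((isKappaFiltered_iff J κ).2 hJ)).some⟩,
    fun _ J _ hJ ↦ by
      have := (isKappaFiltered_iff J κ).1 hJ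
      exact ⟨preservesColimitsOfShape_of_isCardinalPresentable X κ J⟩⟩

variable {C : Type} [SmallCategory C] {κ : Cardinal.{0}}

lemma hasCardinalLT_elements {P : Cᵒᵖ ⥤ Type} (hP : PshSmall κ P) :
    HasCardinalLT P.Elements κ :=
  ((hasCardinalLT_iff_cardinal_mk_lt _ _).2 hP).of_surjective
    (fun x ↦ P.elementsMk (op x.1) x.2) (fun x ↦ ⟨⟨x.1.unop, x.2⟩, rfl⟩)

lemma hasCardinalLT_hom_from (hC : catCard C < κ) (U : Cᵒᵖ) :
    HasCardinalLT (Σ V : Cᵒᵖ, U ⟶ V) κ := by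
  have : HasCardinalLT (Arrow Cᵒᵖ) κ := by
    simpa using (hasCardinalLT_arrow_iff κ).2 hC
  exact ((hasCardinalLT_iff_of_equiv (Arrow.equivSigma Cᵒᵖ) κ).1 this).of_injective
    _
    (sigma_mk_injective (β := fun U : Cᵒᵖ ↦ Σ V : Cᵒᵖ, U ⟶ V) (i := U))

lemma pshSmall_ofSection (hC : catCard C < κ) {P : Cᵒᵖ ⥤ Type} {U : Cᵒᵖ} (x : P.obj U) :
    PshSmall κ (Subfunctor.ofSection x).toFunctor :=
  (hasCardinalLT_iff_cardinal_mk_lt _ _).1 <|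
    (hasCardinalLT_hom_from hC U).of_surjective (fun f ↦ ⟨f.1.unop, P.map f.2 x, f.2, rfl⟩) (by
      rintro ⟨V, y, f, rfl⟩
      exact ⟨⟨op V, f⟩, rfl⟩)

variable [Fact κ.IsRegular]

lemma hasCardinalLT_arrow_elements (hC : catCard C < κ) {P : Cᵒᵖ ⥤ Type} (hP : PshSmall κ P) :
    HasCardinalLT (Arrow P.Elements) κ := by
  refine (hasCardinalLT_sigma (fun p : P.Elements ↦ Σ V : Cᵒᵖ, p.1 ⟶ V) κ
    (hasCardinalLT_elements hP) (fun p ↦ hasCardinalLT_hom_from hC p.1)).of_surjective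
    (fun x ↦ Arrow.mk (Y := P.elementsMk x.2.1 (P.map x.2.2 x.1.2)) ⟨x.2.2, rfl⟩) ?_
  rintro ⟨p, ⟨V, y⟩, f, hf⟩
  change p.1 ⟶ V at f
  change P.map f p.2 = y at hf
  subst hf
  exact ⟨⟨p, V, f⟩, rfl⟩

lemma isCardinalPresentable_of_pshSmall (hC : catCard C < κ) {P : Cᵒᵖ ⥤ Type}
    (hP : PshSmall κ P) : IsCardinalPresentable P κ := by
  have (k : P.Elementsᵒᵖ) :
      IsCardinalPresentable ((Presheaf.functorToRepresentables.{0} P).obj k) κ := by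
    dsimp [Presheaf.functorToRepresentables]
    infer_instance
  exact isCardinalPresentable_of_isColimit' _ (Presheaf.colimitOfRepresentable.{0} P) κ
    (by simpa using hasCardinalLT_arrow_elements hC hP)

lemma pshSmall_iSup {P : Cᵒᵖ ⥤ Type} {ι : Type} (hι : Cardinal.mk ι < κ)
    (A : ι → Subfunctor P) (hA : ∀ i, PshSmall κ (A i).toFunctor) :
    PshSmall κ (⨆ i, A i).toFunctor :=
  (hasCardinalLT_iff_cardinal_mk_lt _ _).1 <|
    (hasCardinalLT_sigma (fun i ↦ Σ c : C, (A i).toFunctor.obj (op c)) κ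
      ((hasCardinalLT_iff_cardinal_mk_lt _ _).2 hι)
      (fun i ↦ (hasCardinalLT_iff_cardinal_mk_lt _ _).2 (hA i))).of_surjective
    (fun x ↦ ⟨x.2.1, x.2.2.1, le_iSup A x.1 _ x.2.2.2⟩) (by
      rintro ⟨c, y, hy⟩
      simp only [Subfunctor.iSup_obj, Set.mem_iUnion] at hy
      obtain ⟨i, hi⟩ := hy
      exact ⟨⟨i, c, y, hi⟩, rfl⟩)

variable (κ) in
/-- The preordered type of `κ`-small subpresheaves of a presheaf. -/
abbrev SmallSubfunctor (P : Cᵒᵖ ⥤ Type) : Type := { A : Subfunctor P // PshSmall κ A.toFunctor }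

instance (P : Cᵒᵖ ⥤ Type) : IsCardinalFiltered (SmallSubfunctor κ P) κ :=
  isCardinalFiltered_preorder _ _ fun _ A hι ↦
    ⟨⟨⨆ i, (A i).1, pshSmall_iSup hι _ fun i ↦ (A i).2⟩, le_iSup fun i ↦ (A i).1⟩

namespace SmallSubfunctor

variable (κ) in
/-- The diagram of `κ`-small subpresheaves of a presheaf. -/
def diagram (P : Cᵒᵖ ⥤ Type) : SmallSubfunctor κ P ⥤ Cᵒᵖ ⥤ Type where
  obj A := A.1.toFunctor
  map f := Subfunctor.homOfLe (leOfHom f)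

variable (κ) in
/-- The cocone of inclusions of the `κ`-small subpresheaves of a presheaf. -/
def cocone (P : Cᵒᵖ ⥤ Type) : Cocone (diagram κ P) where
  pt := P
  ι := { app A := A.1.ι }

/-- If `C` has fewer than `κ` morphisms, every presheaf is the colimit of its `κ`-small
subpresheaves. -/
noncomputable def isColimitCocone (hC : catCard C < κ) (P : Cᵒᵖ ⥤ Type) :
    IsColimit (cocone κ P) := by
  have := isFiltered_of_isCardinalFiltered (SmallSubfunctor κ P) κ
  refine evaluationJointlyReflectsColimits _ fun U ↦
    Types.FilteredColimit.isColimitOf' _ _ (fun x ↦ ?_) ?_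
  · exact ⟨⟨_, pshSmall_ofSection hC x⟩, ⟨x, Subfunctor.mem_ofSection_obj x⟩, rfl⟩
  · rintro A ⟨x, hx⟩ ⟨y, hy⟩ rfl
    exact ⟨A, 𝟙 _, rfl⟩

end SmallSubfunctor

lemma pshSmall_of_isCardinalPresentable (hC : catCard C < κ) (P : Cᵒᵖ ⥤ Type)
    [IsCardinalPresentable P κ] : PshSmall κ P := by
  obtain ⟨A, s, hs⟩ := IsCardinalPresentable.exists_hom_of_isColimit κ
    (SmallSubfunctor.isColimitCocone hC P) (𝟙 P)
  have hs' (U : Cᵒᵖ) (x : P.obj U) : (s ≫ A.1.ι).app U x = x :=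
    ConcreteCategory.congr_hom (NatTrans.congr_app hs U) x
  exact (hasCardinalLT_iff_cardinal_mk_lt _ _).1 <|
    ((hasCardinalLT_iff_cardinal_mk_lt _ _).2 A.2).of_surjective
      (fun x ↦ ⟨x.1, x.2.1⟩) (fun x ↦ ⟨⟨x.1, s.app _ x.2⟩, Sigma.ext rfl (heq_of_eq (hs' _ x.2))⟩)

lemma isKappaCompact_iff_pshSmall (hC : catCard C < κ) (P : Cᵒᵖ ⥤ Type) :
    IsKappaCompact κ P ↔ PshSmall κ P := by
  rw [isKappaCompact_iff]
  exact ⟨fun _ ↦ pshSmall_of_isCardinalPresentable hC P, isCardinalPresentable_of_pshSmall hC⟩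

end PresheafCardinality

/-- Lemma 3.1(b) of the paper (set-valued presheaf form): for `κ` an infinite regular
cardinal with `|C| < κ` and `|C| ≪ κ`, a morphism of presheaves is relative `κ`-compact
iff it is `κ`-small. -/
theorem relCompact_iff_small (C : Type) [SmallCategory C] (κ : Cardinal)
    (hreg : κ.IsRegular) (hinf : ℵ₀ ≤ κ) (hlt : catCard C < κ)
    (hsharp : SharplyLarger (catCard C) κ) {X Y : Cᵒᵖ ⥤ Type} (f : X ⟶ Y) :
    RelKappaCompact κ f ↔ MapSmall κ f := by
  have : Fact κ.IsRegular := ⟨hreg⟩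
  simp only [RelKappaCompact, MapSmall, PresheafCardinality.isKappaCompact_iff_pshSmall hlt]
end

section
/- Let C be a small category and let κ be an uncountable regular cardinal such that ℵ₀ · |C| < κ and κ is sharply larger than ℵ₀ · |C|. Then a morphism f : X ⟶ Y of simplicial presheaves Cᵒᵖ ⥤ SSet is relative κ-compact if and only if f is κ-small. -/
open CategoryTheory CategoryTheory.Limits Cardinal Opposite

/-- A simplicial presheaf `X : Cᵒᵖ ⥤ SSet` is `κ`-small if the sum, over all objects `c`
of `C` and all `n : ℕ`, of the cardinality of the set of `n`-simplices of `X(c)` is less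
than `κ`. -/
def SPshSmall {C : Type} [SmallCategory C] (κ : Cardinal) (X : Cᵒᵖ ⥤ SSet.{0}) : Prop :=
  Cardinal.mk (Σ (c : C) (n : ℕ), (X.obj (op c)).obj (op (SimplexCategory.mk n))) < κ

/-- A morphism `f : X ⟶ Y` of simplicial presheaves is `κ`-small if every pullback of it
along a map with `κ`-small domain has `κ`-small domain. -/
def SMapSmall {C : Type} [SmallCategory C] (κ : Cardinal) {X Y : Cᵒᵖ ⥤ SSet.{0}}
    (f : X ⟶ Y) : Prop :=
  ∀ (Z : Cᵒᵖ ⥤ SSet.{0}) (g : Z ⟶ Y), SPshSmall κ Z → SPshSmall κ (pullback g f)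

namespace CategoryTheory

universe u

section CardinalFiltered

lemma catCard_lt_iff (C : Type) [SmallCategory C] (κ : Cardinal.{0}) :
    catCard C < κ ↔ HasCardinalLT (Arrow C) κ := by
  let e : (Σ (c : C) (c' : C), c ⟶ c') ≃ Arrow C :=
    { toFun := fun x ↦ Arrow.mk x.2.2
      invFun := fun f ↦ ⟨f.left, f.right, f.hom⟩ }
  rw [← hasCardinalLT_iff_of_equiv e, hasCardinalLT_iff_cardinal_mk_lt, catCard]

lemma isKappaFiltered_iff (κ : Cardinal.{0}) [Fact κ.IsRegular] (J : Type) [SmallCategory J] :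
    IsKappaFiltered κ J ↔ IsCardinalFiltered J κ :=
  ⟨fun h ↦ ⟨fun F hA ↦ h _ ((catCard_lt_iff _ κ).2 hA) F⟩,
    fun h K _ hK F ↦ h.nonempty_cocone F ((catCard_lt_iff K κ).1 hK)⟩

lemma isKappaCompact_iff {D : Type u} [Category.{0} D] (κ : Cardinal.{0}) [Fact κ.IsRegular]
    (X : D) : IsKappaCompact κ X ↔ IsCardinalPresentable X κ :=
  ⟨fun h ↦ ⟨fun J _ hJ ↦ (h J ((isKappaFiltered_iff κ J).2 hJ)).some⟩,
    fun _ J _ hJ ↦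
      have := (isKappaFiltered_iff κ J).1 hJ
      ⟨preservesColimitsOfShape_of_isCardinalPresentable X κ J⟩⟩

end CardinalFiltered

section Presheaf

variable {D : Type u} [SmallCategory D] {κ : Cardinal.{u}}

lemma hasCardinalLT_arrow_elements [Fact κ.IsRegular] {E : Type u} [SmallCategory E]
    (hE : HasCardinalLT (Arrow E) κ) (F : E ⥤ Type u) (hF : HasCardinalLT (Σ e, F.obj e) κ) :
    HasCardinalLT (Arrow F.Elements) κ := by
  refine (hasCardinalLT_prod (Cardinal.IsRegular.aleph0_le Fact.out) hE
    (hasCardinalLT_prod (Cardinal.IsRegular.aleph0_le Fact.out) hF hF)).of_injective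
    (fun f ↦ (Arrow.mk f.hom.1, (f.left, f.right))) ?_
  rintro ⟨X, Y, f⟩ ⟨X', Y', f'⟩ h
  obtain ⟨h₁, h₂⟩ := Prod.ext_iff.1 h
  obtain ⟨h₂, h₃⟩ := Prod.ext_iff.1 h₂
  dsimp at h₁ h₂ h₃
  subst h₂ h₃
  obtain rfl : f = f' := Subtype.ext (Arrow.mk_injective _ _ h₁)
  rfl

lemma Presheaf.isCardinalPresentable_of_hasCardinalLT [Fact κ.IsRegular]
    (hD : HasCardinalLT (Arrow D) κ) (F : Dᵒᵖ ⥤ Type u)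
    (hF : HasCardinalLT (Σ d, F.obj d) κ) : IsCardinalPresentable F κ := by
  have (k : F.Elementsᵒᵖ) :
      IsCardinalPresentable ((Presheaf.functorToRepresentables.{u} F).obj k) κ := by
    rw [Presheaf.functorToRepresentables_obj]
    infer_instance
  refine isCardinalPresentable_of_isColimit' _ (Presheaf.colimitOfRepresentable.{u} F) κ ?_
  rw [hasCardinalLT_arrow_op_iff]
  exact hasCardinalLT_arrow_elements (by rwa [hasCardinalLT_arrow_op_iff]) F hF

/-- The subfunctors of `F` which have fewer than `κ` sections. -/
abbrev Subfunctor.CardinalLT (F : Dᵒᵖ ⥤ Type u) (κ : Cardinal.{u}) : Type u :=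
  { S : Subfunctor F // HasCardinalLT (Σ d, S.obj d) κ }

namespace Subfunctor

lemma hasCardinalLT_iSup [Fact κ.IsRegular] {F : Dᵒᵖ ⥤ Type u} {ι : Type u}
    (S : ι → Subfunctor F) (hι : HasCardinalLT ι κ)
    (hS : ∀ i, HasCardinalLT (Σ d, (S i).obj d) κ) :
    HasCardinalLT (Σ d, (⨆ i, S i).obj d) κ := by
  refine (hasCardinalLT_sigma (fun i ↦ Σ d, (S i).obj d) κ hι hS).of_surjective
    (fun x ↦ ⟨x.2.1, x.2.2.1, (le_iSup S x.1) _ x.2.2.2⟩) ?_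
  rintro ⟨d, x, hx⟩
  simp only [iSup_obj, Set.mem_iUnion] at hx
  obtain ⟨i, hi⟩ := hx
  exact ⟨⟨i, d, x, hi⟩, rfl⟩

lemma hasCardinalLT_ofSection (hD : HasCardinalLT (Arrow D) κ) {F : Dᵒᵖ ⥤ Type u} {d : Dᵒᵖ}
    (x : F.obj d) : HasCardinalLT (Σ e, (ofSection x).obj e) κ := by
  have hd : HasCardinalLT (Σ e, (d ⟶ e)) κ :=
    HasCardinalLT.of_injective ((hasCardinalLT_arrow_op_iff D κ).2 hD)
      (fun f ↦ Arrow.mk f.2) (by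
        rintro ⟨e, f⟩ ⟨e', f'⟩ h
        obtain rfl : e = e' := congr_arg (fun g : Arrow Dᵒᵖ ↦ g.right) h
        obtain rfl := Arrow.mk_injective _ _ h
        rfl)
  refine hd.of_surjective (fun f ↦ ⟨f.1, F.map f.2 x, f.2, rfl⟩) ?_
  rintro ⟨e, _, f, rfl⟩
  exact ⟨⟨e, f⟩, rfl⟩

namespace CardinalLT

variable (κ) (F : Dᵒᵖ ⥤ Type u)

instance [Fact κ.IsRegular] : IsCardinalFiltered (CardinalLT F κ) κ :=
  isCardinalFiltered_preorder _ _ (fun _ S hι ↦ ⟨⟨⨆ i, (S i).1,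
    hasCardinalLT_iSup _ (by rwa [hasCardinalLT_iff_cardinal_mk_lt]) (fun i ↦ (S i).2)⟩,
      le_iSup (fun i ↦ (S i).1)⟩)

/-- The diagram of subfunctors of `F` which have fewer than `κ` sections. -/
@[simps]
def functor : CardinalLT F κ ⥤ Dᵒᵖ ⥤ Type u where
  obj S := S.1.toFunctor
  map f := homOfLe (leOfHom f)

/-- The cocone with point `F` given by the subfunctors which have fewer than `κ` sections. -/
@[simps]
def cocone : Cocone (functor κ F) where
  pt := F
  ι := { app S := S.1.ι }

/-- If `D` has fewer than `κ` arrows, any presheaf on `D` is the `κ`-filtered colimit of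
its subfunctors which have fewer than `κ` sections. -/
noncomputable def isColimitCocone [Fact κ.IsRegular] (hD : HasCardinalLT (Arrow D) κ) :
    IsColimit (cocone κ F) :=
  evaluationJointlyReflectsColimits _ (fun d ↦ by
    have := isFiltered_of_isCardinalFiltered (CardinalLT F κ) κ
    refine Types.FilteredColimit.isColimitOf' _ _ (fun x ↦ ?_) ?_
    · exact ⟨⟨ofSection x, hasCardinalLT_ofSection hD x⟩, ⟨x, mem_ofSection_obj x⟩, rfl⟩
    · rintro S ⟨x, hx⟩ ⟨y, hy⟩ h
      obtain rfl : x = y := h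
      exact ⟨S, 𝟙 _, rfl⟩)

end CardinalLT

end Subfunctor

lemma Presheaf.isCardinalPresentable_iff_hasCardinalLT [Fact κ.IsRegular]
    (hD : HasCardinalLT (Arrow D) κ) (F : Dᵒᵖ ⥤ Type u) :
    IsCardinalPresentable F κ ↔ HasCardinalLT (Σ d, F.obj d) κ := by
  refine ⟨fun _ ↦ ?_, isCardinalPresentable_of_hasCardinalLT hD F⟩
  obtain ⟨S, f, hf⟩ := IsCardinalPresentable.exists_hom_of_isColimit κ
    (Subfunctor.CardinalLT.isColimitCocone κ F hD) (𝟙 F)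
  refine S.2.of_surjective (fun x ↦ ⟨x.1, x.2.1⟩) ?_
  rintro ⟨d, x⟩
  have hx : (f ≫ S.1.ι).app d x = x := by
    rw [show f ≫ S.1.ι = 𝟙 F from hf, NatTrans.id_app, ConcreteCategory.id_apply]
  exact ⟨⟨d, f.app d x⟩, congr_arg (Sigma.mk d) hx⟩

end Presheaf

section SimplicialPresheaf

instance : Countable (Arrow SimplexCategory) := by
  have (a b : ℕ) : Countable (Fin (a + 1) →o Fin (b + 1)) := DFunLike.coe_injective.countable
  refine Function.Surjective.countable (α := Σ (a b : ℕ), Fin (a + 1) →o Fin (b + 1))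
    (f := fun x ↦ Arrow.mk (SimplexCategory.Hom.mk x.2.2 :
      SimplexCategory.mk x.1 ⟶ SimplexCategory.mk x.2.1)) ?_
  rintro ⟨X, Y, f⟩
  exact ⟨⟨X.len, Y.len, f.toOrderHom⟩, rfl⟩

lemma hasCardinalLT_arrow_prod {C D : Type u} [SmallCategory C] [SmallCategory D]
    {κ : Cardinal.{u}} (hκ : ℵ₀ ≤ κ) (hC : HasCardinalLT (Arrow C) κ)
    (hD : HasCardinalLT (Arrow D) κ) : HasCardinalLT (Arrow (C × D)) κ := by
  refine (hasCardinalLT_prod hκ hC hD).of_surjective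
    (fun x ↦ Arrow.mk (show (x.1.left, x.2.left) ⟶ (x.1.right, x.2.right) from
      Prod.mkHom x.1.hom x.2.hom)) ?_
  rintro ⟨X, Y, f⟩
  exact ⟨⟨Arrow.mk f.1, Arrow.mk f.2⟩, rfl⟩

variable (C : Type) [SmallCategory C]

/-- Simplicial presheaves on `C` are presheaves of sets on `C × SimplexCategory`. -/
def simplicialPresheafEquivalence :
    (Cᵒᵖ ⥤ SSet.{0}) ≌ ((C × SimplexCategory)ᵒᵖ ⥤ Type) :=
  Functor.currying.trans (prodOpEquiv C).symm.congrLeft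

variable {C} in
lemma sPshSmall_iff (κ : Cardinal.{0}) (X : Cᵒᵖ ⥤ SSet.{0}) :
    SPshSmall κ X ↔
      HasCardinalLT (Σ d, ((simplicialPresheafEquivalence C).functor.obj X).obj d) κ := by
  let e : (Σ (c : C) (n : ℕ), (X.obj (op c)).obj (op (SimplexCategory.mk n))) ≃
      Σ d, ((simplicialPresheafEquivalence C).functor.obj X).obj d :=
    { toFun := fun x ↦ ⟨op (x.1, SimplexCategory.mk x.2.1), x.2.2⟩
      invFun := fun x ↦ ⟨x.1.unop.1, x.1.unop.2.len, x.2⟩ }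
  rw [← hasCardinalLT_iff_of_equiv e, hasCardinalLT_iff_cardinal_mk_lt, SPshSmall]

variable {C} in
lemma isKappaCompact_iff_sPshSmall {κ : Cardinal.{0}} (hreg : κ.IsRegular) (hκ : ℵ₀ < κ)
    (hC : catCard C < κ) (X : Cᵒᵖ ⥤ SSet.{0}) : IsKappaCompact κ X ↔ SPshSmall κ X := by
  have : Fact κ.IsRegular := ⟨hreg⟩
  have hΔ : HasCardinalLT (Arrow SimplexCategory) κ := by
    rw [hasCardinalLT_iff_cardinal_mk_lt]
    exact (Cardinal.mk_le_aleph0).trans_lt hκ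
  rw [isKappaCompact_iff, sPshSmall_iff,
    ← isCardinalPresentable_iff_of_isEquivalence X κ (simplicialPresheafEquivalence C).functor,
    Presheaf.isCardinalPresentable_iff_hasCardinalLT
      (hasCardinalLT_arrow_prod hκ.le ((catCard_lt_iff C κ).1 hC) hΔ)]

end SimplicialPresheaf

end CategoryTheory

/-- Lemma 3.1(b) of the paper for simplicial presheaves over an ordinary small category:
for `κ` an uncountable regular cardinal with `ℵ₀ · |C| < κ` and `ℵ₀ · |C| ≪ κ`, a morphism
of simplicial presheaves is relative `κ`-compact iff it is `κ`-small. -/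
theorem sPsh_relCompact_iff_small (C : Type) [SmallCategory C] (κ : Cardinal)
    (hreg : κ.IsRegular) (huncount : ℵ₀ < κ) (hlt : ℵ₀ * catCard C < κ)
    (hsharp : SharplyLarger (ℵ₀ * catCard C) κ) {X Y : Cᵒᵖ ⥤ SSet.{0}} (f : X ⟶ Y) :
    RelKappaCompact κ f ↔ SMapSmall κ f := by
  have h (Z : Cᵒᵖ ⥤ SSet.{0}) : IsKappaCompact κ Z ↔ SPshSmall κ Z :=
    isKappaCompact_iff_sPshSmall hreg huncount
      ((Cardinal.le_mul_left Cardinal.aleph0_ne_zero).trans_lt hlt) Z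
  simp only [RelKappaCompact, SMapSmall, h]
end

section
/- Let C and D be small categories, let F : (Cᵒᵖ ⥤ Type) ⥤ (Dᵒᵖ ⥤ Type) be a functor admitting a right adjoint G : (Dᵒᵖ ⥤ Type) ⥤ (Cᵒᵖ ⥤ Type), and let κ be a regular cardinal with |C| · |D| < κ and κ sharply larger than |C| · |D|. If F sends every representable presheaf y(c) (for c an object of C) to an object isomorphic to a representable presheaf y(d) (for some object d of D), then G preserves κ-small morphisms: for every κ-small morphism f : X ⟶ Y in Dᵒᵖ ⥤ Type, the morphism G(f) : G(X) ⟶ G(Y) is κ-small in Cᵒᵖ ⥤ Type. -/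
open CategoryTheory CategoryTheory.Limits Cardinal Opposite

/-- Smallness of a presheaf, measured on its generalized elements at representables. -/
theorem pshSmall_iff_mk_yoneda_hom {C : Type} [SmallCategory C] (κ : Cardinal)
    (X : Cᵒᵖ ⥤ Type) : PshSmall κ X ↔ #(Σ c : C, (yoneda.obj c ⟶ X)) < κ := by
  rw [PshSmall, Cardinal.mk_congr (Equiv.sigmaCongrRight fun _ : C => yonedaEquiv)]

/-- The hom-sets into a fixed object together have at most `catCard D` elements. -/
theorem mk_sigma_hom_le_catCard {D : Type} [SmallCategory D] (d : D) :
    #(Σ d' : D, d' ⟶ d) ≤ catCard D :=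
  Cardinal.mk_le_of_injective (f := fun p => (⟨p.1, d, p.2⟩ : Σ (a : D) (b : D), a ⟶ b)) (by
    rintro ⟨a, u⟩ ⟨b, v⟩ h
    obtain rfl : a = b := (Sigma.mk.inj h).1
    have hsnd := eq_of_heq (Sigma.mk.inj h).2
    obtain rfl : u = v := eq_of_heq (Sigma.mk.inj hsnd).2
    rfl)

theorem one_le_catCard {C : Type} [SmallCategory C] (c : C) : 1 ≤ catCard C :=
  Cardinal.one_le_iff_ne_zero.2 (Cardinal.mk_ne_zero_iff.2 ⟨⟨c, c, 𝟙 c⟩⟩)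

/-- Along a `κ`-small morphism, a map out of a `κ`-small representable has fewer than `κ`
lifts. -/
theorem MapSmall.mk_lifts_lt {D : Type} [SmallCategory D] {κ : Cardinal} {X Y : Dᵒᵖ ⥤ Type}
    {f : X ⟶ Y} (hf : MapSmall κ f) {d : D} (hd : PshSmall κ (yoneda.obj d))
    {W : Dᵒᵖ ⥤ Type} (e : W ≅ yoneda.obj d) (h : W ⟶ Y) :
    #{k : W ⟶ X // k ≫ f = h} < κ := by
  refine lt_of_le_of_lt ?_
    ((pshSmall_iff_mk_yoneda_hom κ _).1 (hf (yoneda.obj d) (e.inv ≫ h) hd))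
  refine Cardinal.mk_le_of_injective
    (f := fun k => ⟨d, pullback.lift (𝟙 _) (e.inv ≫ k.1) (by simp [k.2])⟩) ?_
  intro k l hkl
  have hlift := congrArg (· ≫ pullback.snd _ _) (eq_of_heq (Sigma.mk.inj hkl).2)
  simp only [pullback.lift_snd] at hlift
  exact Subtype.ext ((cancel_epi e.inv).1 hlift)

/-- Lemma 3.2 of the paper (set-valued presheaf form, first alternative hypothesis):
if `F ⊣ G` and `F` takes representables to representables, then for `κ` regular with
`|C| · |D| < κ` and `|C| · |D| ≪ κ`, the right adjoint `G` preserves `κ`-small morphisms. -/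
theorem rightAdjoint_preserves_small_maps (C D : Type) [SmallCategory C] [SmallCategory D]
    (F : (Cᵒᵖ ⥤ Type) ⥤ (Dᵒᵖ ⥤ Type)) (G : (Dᵒᵖ ⥤ Type) ⥤ (Cᵒᵖ ⥤ Type)) (adj : F ⊣ G)
    (κ : Cardinal) (hreg : κ.IsRegular)
    (hlt : catCard C * catCard D < κ) (hsharp : SharplyLarger (catCard C * catCard D) κ)
    (hF : ∀ c : C, ∃ d : D, Nonempty (F.obj (yoneda.obj c) ≅ yoneda.obj d))
    {X Y : Dᵒᵖ ⥤ Type} (f : X ⟶ Y) (hf : MapSmall κ f) :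
    MapSmall κ (G.map f) := by
  intro Z g hZ
  rw [pshSmall_iff_mk_yoneda_hom] at hZ ⊢
  have lifts_lt (b : Σ c : C, (yoneda.obj c ⟶ Z)) :
      #{k : F.obj (yoneda.obj b.1) ⟶ X //
        k ≫ f = (adj.homEquiv _ _).symm (b.2 ≫ g)} < κ := by
    obtain ⟨d, ⟨e⟩⟩ := hF b.1
    refine hf.mk_lifts_lt (lt_of_le_of_lt ?_ hlt) e _
    exact (mk_sigma_hom_le_catCard d).trans
      (le_mul_of_one_le_left zero_le (one_le_catCard b.1))
  refine lt_of_le_of_lt ?_ (Cardinal.sum_lt_of_isRegular hreg hZ lifts_lt)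
  rw [← Cardinal.mk_sigma]
  refine Cardinal.mk_le_of_injective (f := fun a =>
    ⟨⟨a.1, a.2 ≫ pullback.fst _ _⟩, (adj.homEquiv _ _).symm (a.2 ≫ pullback.snd _ _), by
      rw [← adj.homEquiv_naturality_right_symm, Category.assoc, Category.assoc,
        pullback.condition]⟩) ?_
  rintro ⟨c, a⟩ ⟨c', a'⟩ h
  obtain ⟨hbase, hlift⟩ := Sigma.mk.inj h
  obtain rfl : c = c' := (Sigma.mk.inj hbase).1
  have hfst : a ≫ pullback.fst _ _ = a' ≫ pullback.fst _ _ :=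
    eq_of_heq (Sigma.mk.inj hbase).2
  have hsnd : a ≫ pullback.snd _ _ = a' ≫ pullback.snd _ _ := by
    apply (adj.homEquiv _ _).symm.injective
    refine (Subtype.heq_iff_coe_eq fun k => ?_).1 hlift
    simp only [hfst]
  rw [pullback.hom_ext hfst hsnd]
end
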